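/- arXiv:2107.05668 — 3 statements merged into one kernel-verified Lean document; each statement's English description precedes it below -/
import Mathlib

section
/- Let R be a commutative ring in which 2 is invertible, let s, t ∈ R, and let M be an R-module. Define x ▷ y = t·x + (s−t)·y, x ▷̄ y = s·x, and x • y = 2⁻¹(s+t)·x + 2⁻¹(s−t)·y. Then for all x, y, z ∈ M the following identities (psyquandle axiom (v), where • plays the role of both •̲ and •̄) hold: (x ▷̄ y) ▷̄ (z • y) = (x ▷̄ z) ▷̄ (y • z); (x ▷ y) ▷ (z • y) = (x ▷ z) ▷ (y • z); (x ▷̄ y) • (z ▷̄ y) = (x • z) ▷̄ (y ▷ z); and (x ▷ y) • (z ▷ y) = (x • z) ▷ (y ▷̄ z). -/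
/-- The Jablan psyquandle operations satisfy psyquandle axiom (v); since the
underbullet and overbullet operations coincide, the six identities reduce to
the four listed here. -/
theorem jablan_axiom_v (R : Type*) [CommRing R] [Invertible (2 : R)]
    (s t : R) (M : Type*) [AddCommGroup M] [Module R M]
    (tri : M → M → M) (bar : M → M → M) (bullet : M → M → M)
    (htri : ∀ x y, tri x y = t • x + (s - t) • y)
    (hbar : ∀ x y, bar x y = s • x)
    (hbullet : ∀ x y, bullet x y = (⅟(2 : R) * (s + t)) • x + (⅟(2 : R) * (s - t)) • y) :
    ∀ x y z : M,
      bar (bar x y) (bullet z y) = bar (bar x z) (bullet y z) ∧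
      tri (tri x y) (bullet z y) = tri (tri x z) (bullet y z) ∧
      bullet (bar x y) (bar z y) = bar (bullet x z) (tri y z) ∧
      bullet (tri x y) (tri z y) = tri (bullet x z) (bar y z) := by
  have two_inv : ⅟(2 : R) * 2 = 1 := invOf_mul_self 2
  intro x y z
  simp only [htri, hbar, hbullet]
  refine ⟨trivial, ?_, ?_, ?_⟩
  · linear_combination (norm := module) two_inv • (((s - t) * t) • (z - y))
  · module
  · linear_combination (norm := module) two_inv • ((s * (s - t)) • y)
end

section
/- Let R be a commutative ring in which 2 and s+t are invertible, where s, t ∈ R, and let M be an R-module. Define x ▷ y = t·x + (s−t)·y, x ▷̄ y = s·x, x • y = a·x + b·y where a = 2⁻¹(s+t) and b = 2⁻¹(s−t), and define the right inverse operation w •⁻¹ v = a⁻¹·(w − b·v) (so that (w •⁻¹ v) • v = w for all w, v). Then for all x, y ∈ M the two identities of psyquandle axiom (iv) hold: x • ((y ▷̄ x) •⁻¹ x) = ((x ▷ y) •⁻¹ y) ▷̄ ((y ▷̄ x) •⁻¹ x), and y • ((x ▷ y) •⁻¹ y) = ((y ▷̄ x) •⁻¹ x) ▷ ((x ▷ y)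 •⁻¹ y). -/
/-- The Jablan psyquandle operations satisfy psyquandle axiom (iv), where the
right inverse of the bullet operation `x • y = a•x + b•y` (with `a = 2⁻¹(s+t)`,
`b = 2⁻¹(s-t)`) is `w •⁻¹ v = a⁻¹•(w - b•v)`. -/
theorem jablan_axiom_iv (R : Type*) [CommRing R] [Invertible (2 : R)]
    (s t : R) [Invertible (s + t)]
    (M : Type*) [AddCommGroup M] [Module R M]
    (tri : M → M → M) (bar : M → M → M) (bullet : M → M → M) (bulletInv : M → M → M)
    (a b : R) (ha : a = ⅟(2 : R) * (s + t)) (hb : b = ⅟(2 : R) * (s - t))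
    (htri : ∀ x y, tri x y = t • x + (s - t) • y)
    (hbar : ∀ x y, bar x y = s • x)
    (hbullet : ∀ x y, bullet x y = a • x + b • y)
    (hbulletInv : ∀ w v, bulletInv w v = (2 * ⅟(s + t)) • (w - b • v)) :
    (∀ w v : M, bullet (bulletInv w v) v = w) ∧
    ∀ x y : M,
      bullet x (bulletInv (bar y x) x) =
        bar (bulletInv (tri x y) y) (bulletInv (bar y x) x) ∧
      bullet y (bulletInv (tri x y) y) =
        tri (bulletInv (bar y x) x) (bulletInv (tri x y) y) := by
  have h2 : (2 : R) * ⅟(2 : R) = 1 := mul_invOf_self _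
  have hu : (s + t) * ⅟(s + t) = 1 := mul_invOf_self _
  have hav : a * (2 * ⅟(s + t)) = 1 := by
    rw [ha]
    linear_combination (s + t) * ⅟(s + t) * h2 + hu
  have h2b : 2 * b = s - t := by
    rw [hb]
    linear_combination (s - t) * h2
  have hst : a ^ 2 - b ^ 2 = s * t := by
    rw [ha, hb]
    linear_combination s * t * (2 * ⅟(2 : R) + 1) * h2
  simp only [htri, hbar, hbullet, hbulletInv]
  clear htri hbar hbullet hbulletInv ha hb h2 hu
  generalize 2 * ⅟(s + t) = v at *
  refine ⟨fun w z => ?_, fun x y => ⟨?_, ?_⟩⟩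
  · match_scalars
    · linear_combination hav
    · linear_combination -b * hav
  · match_scalars
    · linear_combination -a * hav + v * hst
    · linear_combination s * v * h2b
  · match_scalars
    · linear_combination -a * hav + v * hst + v * (s - t) * h2b
    · linear_combination t * v * h2b
end

section
/- Let R be a commutative ring in which 2, s, t, and s+t are all invertible, where s, t ∈ R, and let M be an R-module. Define x ▷ y = t·x + (s−t)·y, x ▷̄ y = s·x, and x •̲ y = x •̄ y = 2⁻¹(s+t)·x + 2⁻¹(s−t)·y. Then these four operations satisfy all of the psyquandle axioms: (0) each of the four operations is right-invertible (for each fixed y, the maps x ↦ x ▷ y, x ↦ x ▷̄ y, x ↦ x •̲ y, x ↦ x •̄ y are bijections of M); (i) x ▷ x = x ▷̄ x for all x; (ii) the maps S(x,y) = (y ▷̄ x, x ▷ y) and S'(x,y) = (y •̄ x, x •̲ y) are bijections of M × M; (iii) the three exchange laws hold for all x, y, z; (iv) the two axiom-(iv) identities hold for all x, y (with the right inverse of •̄); (v) the six axiom-(v) identities hold for all x, y, z; and (vi) x •̲ x = x •̄ x for all x. In other words, M with these operations is a pI-adequate psyquandle (the Jablan psyquandle). -/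
theorem IsUnit.bijective_smul_add {R M : Type*} [CommRing R] [AddCommGroup M] [Module R M]
    {r : R} (hr : IsUnit r) (v : M) : Function.Bijective (fun x : M => r • x + v) :=
  (AddGroup.addRight_bijective v).comp (MulAction.bijective hr.unit)

/-- A linear map `M × M → M × M` given by a two-by-two matrix with invertible determinant
is bijective. -/
theorem bijective_prod_of_isUnit_det {R M : Type*} [CommRing R] [AddCommGroup M] [Module R M]
    {p q r u : R} (h : IsUnit (p * r - q * u)) :
    Function.Bijective (fun z : M × M => (p • z.2 + q • z.1, r • z.1 + u • z.2)) := by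
  obtain ⟨d, hd⟩ := h.exists_left_inv
  refine Function.bijective_iff_has_inverse.mpr
    ⟨fun w => (d • (p • w.2 - u • w.1), d • (r • w.1 - q • w.2)), fun z => ?_, fun w => ?_⟩
  · ext
    · linear_combination (norm := module) hd • z.1
    · linear_combination (norm := module) hd • z.2
  · ext
    · linear_combination (norm := module) hd • w.1
    · linear_combination (norm := module) hd • w.2

/-- When `2`, `s`, `t`, and `s+t` are all invertible, the Jablan operations
`x ▷ y = t•x + (s-t)•y`, `x ▷̄ y = s•x`, `x •̲ y = x •̄ y = 2⁻¹(s+t)•x + 2⁻¹(s-t)•y`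
on an `R`-module `M` satisfy all of the psyquandle axioms (0)-(v) together with
the pI-adequacy axiom (vi): `M` is a pI-adequate psyquandle (the Jablan psyquandle). -/
theorem jablan_is_pI_adequate_psyquandle (R : Type*) [CommRing R]
    [Invertible (2 : R)] (s t : R) (hs : IsUnit s) (ht : IsUnit t) (hst : IsUnit (s + t))
    (M : Type*) [AddCommGroup M] [Module R M]
    (tri : M → M → M) (bar : M → M → M) (ubul : M → M → M) (obul : M → M → M)
    (obulInv : M → M → M)
    (htri : ∀ x y, tri x y = t • x + (s - t) • y)
    (hbar : ∀ x y, bar x y = s • x)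
    (hubul : ∀ x y, ubul x y = (⅟(2 : R) * (s + t)) • x + (⅟(2 : R) * (s - t)) • y)
    (hobul : ∀ x y, obul x y = (⅟(2 : R) * (s + t)) • x + (⅟(2 : R) * (s - t)) • y)
    (hobulInv : ∀ w v, obul (obulInv w v) v = w ∧ obulInv (obul w v) v = w) :
    -- axiom (0): right invertibility of all four operations
    (∀ y : M, Function.Bijective (fun x => tri x y) ∧
              Function.Bijective (fun x => bar x y) ∧
              Function.Bijective (fun x => ubul x y) ∧
              Function.Bijective (fun x => obul x y)) ∧
    -- axiom (i)
    (∀ x : M, tri x x = bar x x) ∧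
    -- axiom (ii)
    (Function.Bijective (fun p : M × M => (bar p.2 p.1, tri p.1 p.2)) ∧
     Function.Bijective (fun p : M × M => (obul p.2 p.1, ubul p.1 p.2))) ∧
    -- axiom (iii): exchange laws
    (∀ x y z : M,
      tri (tri x y) (tri z y) = tri (tri x z) (bar y x) ∧
      bar (tri x y) (tri z y) = tri (bar x z) (bar y x) ∧
      bar (bar x y) (bar z y) = bar (bar x z) (tri y x)) ∧
    -- axiom (iv)
    (∀ x y : M,
      ubul x (obulInv (bar y x) x) =
        bar (obulInv (tri x y) y) (obulInv (bar y x) x) ∧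
      ubul y (obulInv (tri x y) y) =
        tri (obulInv (bar y x) x) (obulInv (tri x y) y)) ∧
    -- axiom (v)
    (∀ x y z : M,
      bar (bar x y) (obul z y) = bar (bar x z) (ubul y z) ∧
      tri (tri x y) (obul z y) = tri (tri x z) (ubul y z) ∧
      obul (bar x y) (bar z y) = bar (obul x z) (tri y z) ∧
      ubul (tri x y) (tri z y) = tri (ubul x z) (bar y z) ∧
      ubul (bar x y) (bar z y) = bar (ubul x z) (tri y z) ∧
      obul (tri x y) (tri z y) = tri (obul x z) (bar y z)) ∧
    -- axiom (vi): pI-adequacy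
    (∀ x : M, ubul x x = obul x x) := by
  have h2 : ⅟(2 : R) * 2 = 1 := invOf_mul_self 2
  obtain ⟨a, b, rfl, rfl⟩ : ∃ a b : R, s = a + b ∧ t = a - b :=
    ⟨⅟2 * (s + t), ⅟2 * (s - t), by linear_combination -s * h2, by linear_combination -t * h2⟩
  have hA : ⅟(2 : R) * (a + b + (a - b)) = a := by linear_combination a * h2
  have hB : ⅟(2 : R) * (a + b - (a - b)) = b := by linear_combination b * h2
  have ha : IsUnit a := hA ▸ (isUnit_of_invertible (⅟(2 : R))).mul hst
  rw [hA, hB] at hubul hobul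
  have hinv (w v : M) : a • obulInv w v + b • v = w := by rw [← hobul, (hobulInv w v).1]
  refine ⟨fun y => ⟨?_, ?_, ?_, ?_⟩, fun x => ?_, ⟨?_, ?_⟩, fun x y z => ⟨?_, ?_, ?_⟩,
    fun x y => ⟨?_, ?_⟩, fun x y z => ⟨?_, ?_, ?_, ?_, ?_, ?_⟩, fun x => ?_⟩
  · simpa only [htri] using ht.bijective_smul_add _
  · simpa only [hbar, add_zero] using hs.bijective_smul_add (0 : M)
  · simpa only [hubul] using ha.bijective_smul_add _
  · simpa only [hobul] using ha.bijective_smul_add _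
  · simp only [htri, hbar]
    module
  · have h := bijective_prod_of_isUnit_det (M := M) (p := a + b) (q := 0) (r := a - b)
      (u := a + b - (a - b)) (by simpa only [zero_mul, sub_zero] using hs.mul ht)
    simpa only [htri, hbar, zero_smul, add_zero] using h
  · have h := bijective_prod_of_isUnit_det (M := M) (p := a) (q := b) (r := a) (u := b)
      (by rw [← sq, ← sq, sq_sub_sq]; exact hs.mul ht)
    simpa only [hubul, hobul] using h
  · simp only [htri, hbar]
    module
  · simp only [htri, hbar]
    module
  · simp only [hbar]
  · have hu := hinv (bar y x) x
    have hv := hinv (tri x y) y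
    generalize obulInv (bar y x) x = u at *
    generalize obulInv (tri x y) y = v at *
    rw [hbar] at hu
    rw [htri] at hv
    rw [hubul, hbar]
    refine ha.smul_left_cancel.mp ?_
    linear_combination (norm := module) b • hu - (a + b) • hv
  · have hu := hinv (bar y x) x
    have hv := hinv (tri x y) y
    generalize obulInv (bar y x) x = u at *
    generalize obulInv (tri x y) y = v at *
    rw [hbar] at hu
    rw [htri] at hv
    rw [hubul, htri]
    refine ha.smul_left_cancel.mp ?_
    linear_combination (norm := module) -(a - b) • hu - b • hv
  · simp only [hbar]
  · simp only [htri, hubul, hobul]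
    module
  · simp only [hbar, htri, hobul]
    module
  · simp only [htri, hbar, hubul]
    module
  · simp only [hbar, htri, hubul]
    module
  · simp only [htri, hbar, hobul]
    module
  · rw [hubul, hobul]
end
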